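/- Let (H, dist) be a pseudometric space and let f be a map from the vertices of the singly-negative signed 6-cycle C₆⁻ to H such that f ∘ ψ = f for every sign-preserving automorphism ψ of C₆⁻. Then f(v₀) = f(v₁), hence dist(f(v₀), f(v₁)) = 0, and both conditions (a) and (b) of adequate representation fail at v₀: there is no ε > 0 with dist(f(v₀), f(v₁)) > ε, and dist(f(v₀), f(v₅)) < dist(f(v₀), f(v₁)) is impossible. In particular, f(v₀) is not an adequate representation of v₀. -/

import Mathlib

/-- A signed graph: a finite simple graph together with a sign function on
unordered pairs of vertices (`true` = positive edge, `false` = negative edge). -/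
structure SignedGraph (V : Type*) where
  G : SimpleGraph V
  sign : Sym2 V → Bool

namespace SignedGraph

/-- The set `N⁺(v)` of positive neighbors of `v`. -/
def posSet {V : Type*} (S : SignedGraph V) (v : V) : Set V :=
  {u | S.G.Adj v u ∧ S.sign s(v, u) = true}

/-- The set `N⁻(v)` of negative neighbors of `v`. -/
def negSet {V : Type*} (S : SignedGraph V) (v : V) : Set V :=
  {u | S.G.Adj v u ∧ S.sign s(v, u) = false}

/-- A sign-preserving automorphism of a signed graph: a permutation of the
vertices preserving adjacency and edge signs. -/
def IsSignAuto {V : Type*} (S : SignedGraph V) (ψ : Equiv.Perm V) : Prop :=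
  (∀ u v, S.G.Adj (ψ u) (ψ v) ↔ S.G.Adj u v) ∧
  (∀ u v, S.G.Adj u v → S.sign s(ψ u, ψ v) = S.sign s(u, v))

/-- `f v` is an adequate representation of the vertex `v`:
(a) some `ε > 0` separates `f v` from the images of all negative neighbors, and
(b) images of positive neighbors are strictly closer than those of negative
neighbors. -/
def Adequate {V H : Type*} [PseudoMetricSpace H] (S : SignedGraph V) (f : V → H)
    (v : V) : Prop :=
  (∃ ε > 0, ∀ u ∈ S.negSet v, dist (f v) (f u) > ε) ∧
  (∀ u ∈ S.posSet v, ∀ w ∈ S.negSet v, dist (f v) (f u) < dist (f v) (f w))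

end SignedGraph

/-- The underlying (unsigned) cycle graph on `ZMod n`: `u` and `v` are adjacent
iff they differ by one. -/
def cycleGraph (n : ℕ) : SimpleGraph (ZMod n) :=
  SimpleGraph.fromRel (fun u v => v = u + 1)

instance (n : ℕ) : DecidableRel (cycleGraph n).Adj := fun u v =>
  decidable_of_iff (u ≠ v ∧ (v = u + 1 ∨ u = v + 1))
    (by unfold cycleGraph; exact (SimpleGraph.fromRel_adj (fun a b => b = a + 1) u v).symm)

/-- The singly-negative signed `n`-cycle `Cₙ⁻`: vertices `0, …, n - 1` in
`ZMod n`, edges between consecutive vertices, with the edge `{0, 1}` negative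
and all other edges positive. -/
def negCycle (n : ℕ) : SignedGraph (ZMod n) where
  G := cycleGraph n
  sign := fun e => !(decide (e = s((0 : ZMod n), (1 : ZMod n))))

instance (n : ℕ) : DecidableRel (negCycle n).G.Adj :=
  inferInstanceAs (DecidableRel (cycleGraph n).Adj)

theorem cycleGraph_adj {n : ℕ} {u v : ZMod n} :
    (cycleGraph n).Adj u v ↔ u ≠ v ∧ (v = u + 1 ∨ u = v + 1) :=
  SimpleGraph.fromRel_adj _ u v

/-- The reflection `k ↦ 1 - k` is a sign-preserving automorphism of `Cₙ⁻`. -/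
theorem negCycle_isSignAuto_subLeft (n : ℕ) :
    (negCycle n).IsSignAuto (Equiv.subLeft 1) := by
  refine ⟨fun u v => ?_, fun u v _ => ?_⟩
  · simp only [negCycle, cycleGraph_adj, Equiv.subLeft_apply]
    grind
  · simp only [negCycle, Equiv.subLeft_apply, Sym2.eq_iff]
    grind

open SignedGraph in
/-- Any map on the vertices of `C₆⁻` that is invariant under every
sign-preserving automorphism identifies `f v₀` and `f v₁`; hence both
conditions of adequate representation fail at `v₀`, and `f v₀` is not an
adequate representation of `v₀`. -/
theorem negCycle6_not_adequate {H : Type*} [PseudoMetricSpace H]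
    (f : ZMod 6 → H)
    (hf : ∀ ψ : Equiv.Perm (ZMod 6), (negCycle 6).IsSignAuto ψ → f ∘ ψ = f) :
    f 0 = f 1 ∧ dist (f 0) (f 1) = 0 ∧
    ¬ (∃ ε > (0 : ℝ), dist (f 0) (f 1) > ε) ∧
    ¬ (dist (f 0) (f 5) < dist (f 0) (f 1)) ∧
    ¬ (negCycle 6).Adequate f 0 := by
  have h : f 0 = f 1 := by
    simpa using (congrFun (hf _ (negCycle_isSignAuto_subLeft 6)) 0).symm
  have hd : dist (f 0) (f 1) = 0 := by rw [h, dist_self]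
  have hmem : (1 : ZMod 6) ∈ (negCycle 6).negSet 0 :=
    ⟨cycleGraph_adj.2 (by decide), by simp [negCycle]⟩
  refine ⟨h, hd, ?_, ?_, ?_⟩
  · rintro ⟨ε, hε, hlt⟩
    exact (hε.trans hlt).ne' hd
  · rw [hd]
    exact dist_nonneg.not_gt
  · rintro ⟨⟨ε, hε, hlt⟩, -⟩
    exact (hε.trans (hlt 1 hmem)).ne' hd
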